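/- arXiv:1507.01899 — 2 statements merged into one kernel-verified Lean document; each statement's English description precedes it below -/
import Mathlib

section
/- Every discrete persistence module M : Z → Vec (Z the integers as a poset, all M_i finite-dimensional) decomposes into a direct sum of interval persistence modules. -/
open scoped DirectSum

/-- A zigzag persistence module over `F`: vector spaces `V i` for `i : ℤ`, with
structure maps `f i : V i → V (i+1)` and `g i : V i → V (i-1)` at each even index `i`
(so sinks are at odd indices and sources at even indices). -/
structure Zigzag (F : Type) [Field F] : Type 1 where
  V : ℤ → Type
  acg : ∀ i, AddCommGroup (V i)
  mod : ∀ i, Module F (V i)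
  f : ∀ i : ℤ, Even i → (V i →ₗ[F] V (i + 1))
  g : ∀ i : ℤ, Even i → (V i →ₗ[F] V (i - 1))

attribute [instance] Zigzag.acg Zigzag.mod

namespace Zigzag

variable {F : Type} [Field F]

/-- The zero persistence module predicate. -/
def IsZero (M : Zigzag F) : Prop := ∀ i, ∀ x : M.V i, x = 0

/-- `M` vanishes on the index interval `[s,t]`. -/
def VanishesOn (M : Zigzag F) (s t : ℤ) : Prop :=
  ∀ i, s ≤ i → i ≤ t → ∀ x : M.V i, x = 0

/-- An isomorphism of zigzag persistence modules: a family of linear equivalences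
commuting with the structure maps. -/
structure Iso (M N : Zigzag F) where
  e : ∀ i, M.V i ≃ₗ[F] N.V i
  comm_f : ∀ (i : ℤ) (h : Even i) (x : M.V i), e (i + 1) (M.f i h x) = N.f i h (e i x)
  comm_g : ∀ (i : ℤ) (h : Even i) (x : M.V i), e (i - 1) (M.g i h x) = N.g i h (e i x)

/-- A morphism of zigzag persistence modules. -/
structure Hom (M N : Zigzag F) where
  h : ∀ i, M.V i →ₗ[F] N.V i
  comm_f : ∀ (i : ℤ) (hi : Even i) (x : M.V i), h (i + 1) (M.f i hi x) = N.f i hi (h i x)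
  comm_g : ∀ (i : ℤ) (hi : Even i) (x : M.V i), h (i - 1) (M.g i hi x) = N.g i hi (h i x)

/-- Binary (pointwise) direct sum of zigzag persistence modules. -/
def dsum (M N : Zigzag F) : Zigzag F where
  V i := M.V i × N.V i
  acg i := inferInstance
  mod i := inferInstance
  f i h := (M.f i h).prodMap (N.f i h)
  g i h := (M.g i h).prodMap (N.g i h)

/-- `M` is decomposable if it is isomorphic to a direct sum of two non-zero modules. -/
def Decomposable (M : Zigzag F) : Prop :=
  ∃ U W : Zigzag F, Nonempty (Iso M (U.dsum W)) ∧ ¬ U.IsZero ∧ ¬ W.IsZero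

/-- `M` is indecomposable: non-zero, and in any decomposition one summand is zero. -/
def Indecomposable (M : Zigzag F) : Prop :=
  ¬ M.IsZero ∧ ∀ U W : Zigzag F, Iso M (U.dsum W) → U.IsZero ∨ W.IsZero

/-- `M` is `[s,t]`-indecomposable: non-zero, and in any decomposition one summand
vanishes on all indices in `[s,t]`. -/
def IndecOn (M : Zigzag F) (s t : ℤ) : Prop :=
  ¬ M.IsZero ∧ ∀ U W : Zigzag F, Iso M (U.dsum W) → U.VanishesOn s t ∨ W.VanishesOn s t

/-- Direct sum of an arbitrary family of zigzag persistence modules (pointwise). -/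
noncomputable def dSum {J : Type} (W : J → Zigzag F) : Zigzag F where
  V i := ⨁ j, (W j).V i
  acg i := inferInstance
  mod i := inferInstance
  f i h :=
    letI := Classical.decEq J
    DirectSum.toModule F J _ fun j => (DirectSum.lof F J (fun j => (W j).V (i + 1)) j).comp ((W j).f i h)
  g i h :=
    letI := Classical.decEq J
    DirectSum.toModule F J _ fun j => (DirectSum.lof F J (fun j => (W j).V (i - 1)) j).comp ((W j).g i h)

/-- An auxiliary linear map `(PLift P → A) → (PLift Q → B)` induced by `φ : A →ₗ B`:
it is `φ` (under the canonical identifications) when `P` holds, and `0` otherwise. -/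
noncomputable def transferMap (F : Type) [Field F] {P Q : Prop} {A B : Type} [AddCommGroup A]
    [Module F A] [AddCommGroup B] [Module F B] (φ : A →ₗ[F] B) :
    (PLift P → A) →ₗ[F] (PLift Q → B) where
  toFun x := fun _ => letI := Classical.dec P; if hp : P then φ (x ⟨hp⟩) else 0
  map_add' x y := by funext hq; by_cases hp : P <;> simp [hp]
  map_smul' c x := by funext hq; by_cases hp : P <;> simp [hp]

/-- The extended integers `ℤ ∪ {±∞}`. -/
abbrev EInt : Type := WithBot (WithTop ℤ)

/-- Canonical inclusion of `ℤ` into `ℤ ∪ {±∞}`. -/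
def toE (i : ℤ) : EInt := ((i : WithTop ℤ) : WithBot (WithTop ℤ))

/-- Membership of an integer in the extended interval `[a, b]`. -/
def memI (a b : EInt) (i : ℤ) : Prop := a ≤ toE i ∧ toE i ≤ b

/-- The interval zigzag persistence module `I^[a,b]` for `a ≤ b` in `ℤ ∪ {±∞}`:
it is `F` on indices in `[a,b]` and `0` elsewhere, with identity maps between
non-zero spaces. -/
noncomputable def interval (F : Type) [Field F] (a b : EInt) : Zigzag F where
  V i := PLift (memI a b i) → F
  acg i := inferInstance
  mod i := inferInstance
  f i _ := transferMap F LinearMap.id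
  g i _ := transferMap F LinearMap.id

/-- The restriction of `M` to the index interval `[s,t]`, realized as the zigzag
module agreeing with `M` on `[s,t]` and vanishing elsewhere (extension by zero;
this carries exactly the data of the restriction of `M` to the full subcategory
on `{s, …, t}`). -/
noncomputable def restrict (M : Zigzag F) (s t : ℤ) : Zigzag F where
  V i := PLift (s ≤ i ∧ i ≤ t) → M.V i
  acg i := inferInstance
  mod i := inferInstance
  f i h := transferMap F (M.f i h)
  g i h := transferMap F (M.g i h)

end Zigzag


/-- A discrete persistence module: a functor `ℤ → Vec`. -/
structure PersMod (F : Type) [Field F] : Type 1 where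
  V : ℤ → Type
  acg : ∀ i, AddCommGroup (V i)
  mod : ∀ i, Module F (V i)
  φ : ∀ i : ℤ, V i →ₗ[F] V (i + 1)

attribute [instance] PersMod.acg PersMod.mod

namespace PersMod

variable {F : Type} [Field F]

/-- Isomorphism of discrete persistence modules. -/
structure Iso (M N : PersMod F) where
  e : ∀ i, M.V i ≃ₗ[F] N.V i
  comm : ∀ (i : ℤ) (x : M.V i), e (i + 1) (M.φ i x) = N.φ i (e i x)

/-- Pointwise direct sum of a family of discrete persistence modules. -/
noncomputable def dSum {J : Type} (W : J → PersMod F) : PersMod F where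
  V i := ⨁ j, (W j).V i
  acg i := inferInstance
  mod i := inferInstance
  φ i :=
    letI := Classical.decEq J
    DirectSum.toModule F J _ fun j =>
      (DirectSum.lof F J (fun j => (W j).V (i + 1)) j).comp ((W j).φ i)

/-- The interval discrete persistence module `I^[a,b]` for `a ≤ b` in `ℤ ∪ {±∞}`:
`F` on `[a,b]`, zero elsewhere, identity maps between non-zero spaces. -/
noncomputable def interval (F : Type) [Field F] (a b : Zigzag.EInt) : PersMod F where
  V i := PLift (Zigzag.memI a b i) → F
  acg i := inferInstance
  mod i := inferInstance
  φ i := Zigzag.transferMap F LinearMap.id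

end PersMod

namespace Zigzag

theorem toE_le_toE {i j : ℤ} : toE i ≤ toE j ↔ i ≤ j := by
  simp [toE]

theorem toE_lt_toE {i j : ℤ} : toE i < toE j ↔ i < j := by
  simp [toE]

theorem EInt.cases (a : EInt) : a = ⊥ ∨ a = ⊤ ∨ ∃ n : ℤ, a = toE n := by
  induction a using WithBot.recBotCoe with
  | bot => exact Or.inl rfl
  | coe a =>
    induction a using WithTop.recTopCoe with
    | top => exact Or.inr (Or.inl rfl)
    | coe n => exact Or.inr (Or.inr ⟨n, rfl⟩)

theorem EInt.toE_pred_lt {b : EInt} {i : ℤ} (h : toE i ≤ b) : toE (i - 1) < b :=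
  lt_of_lt_of_le (toE_lt_toE.2 (by omega)) h

/-- A non-empty set of extended integers either has a least element or contains arbitrarily
small integers. -/
theorem EInt.exists_least_or (C : Set EInt) (hC : C.Nonempty) :
    (∃ a ∈ C, ∀ a' ∈ C, a ≤ a') ∨ ∀ n : ℤ, ∃ m ≤ n, toE m ∈ C := by
  by_cases hbot : (⊥ : EInt) ∈ C
  · exact Or.inl ⟨⊥, hbot, fun _ _ => bot_le⟩
  by_cases hint : ∃ n : ℤ, toE n ∈ C
  · by_cases hbdd : ∃ m : ℤ, ∀ n : ℤ, toE n ∈ C → m ≤ n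
    · obtain ⟨n, hn, hmin⟩ := Int.exists_least_of_bdd hbdd hint
      refine Or.inl ⟨toE n, hn, fun a ha => ?_⟩
      rcases EInt.cases a with rfl | rfl | ⟨k, rfl⟩
      · exact absurd ha hbot
      · exact le_top
      · exact toE_le_toE.2 (hmin k ha)
    · push Not at hbdd
      refine Or.inr fun n => ?_
      obtain ⟨m, hm, hlt⟩ := hbdd n
      exact ⟨m, hlt.le, hm⟩
  · obtain ⟨a, ha⟩ := hC
    refine Or.inl ⟨a, ha, fun a' ha' => ?_⟩
    rcases EInt.cases a' with rfl | rfl | ⟨k, rfl⟩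
    · exact absurd ha' hbot
    · exact le_top
    · exact absurd ⟨k, ha'⟩ hint

end Zigzag

/-- A submodule `N ≤ G` of a vector space has a complement in `G` that admits a basis. -/
theorem Submodule.exists_basis_compl {F E : Type} [Field F] [AddCommGroup E] [Module F E]
    {N G : Submodule F E} (hNG : N ≤ G) :
    ∃ (ι : Type) (s : ι → E), (∀ k, s k ∈ G) ∧
      (∀ c : ι →₀ F, Finsupp.linearCombination F s c ∈ N → c = 0) ∧
      G ≤ Submodule.span F (Set.range s) ⊔ N := by
  obtain ⟨C, hC⟩ := N.exists_isCompl
  let B := Module.Basis.ofVectorSpace F ↥(C ⊓ G)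
  refine ⟨_, fun k => (B k : E), fun k => (B k).2.2, fun c hc => ?_, ?_⟩
  · have h : Finsupp.linearCombination F (fun k => (B k : E)) c =
        ((Finsupp.linearCombination F B c : ↥(C ⊓ G)) : E) := by
      simp [Finsupp.linearCombination_apply, Finsupp.sum]
    rw [h] at hc
    have h0 := (Submodule.disjoint_def.1 hC.disjoint) _ hc
      (Finsupp.linearCombination F B c).2.1
    exact linearIndependent_iff.1 B.linearIndependent c (Subtype.ext h0)
  · have hspan : Submodule.span F (Set.range fun k => (B k : E)) = C ⊓ G := by
      have := congrArg (Submodule.map (C ⊓ G).subtype) B.span_eq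
      rw [Submodule.map_span, ← Set.range_comp, Submodule.map_top, Submodule.range_subtype] at this
      exact this
    rw [hspan, sup_comm, ← sup_inf_assoc_of_le C hNG, hC.sup_eq_top, top_inf_eq]

namespace PersMod

open Zigzag hiding EInt

variable {F : Type} [Field F]

/-- Families of vectors that are compatible with the structure maps from index `a` on and
vanish beyond index `b`. -/
def strings (M : PersMod F) (a b : Zigzag.EInt) : Submodule F (∀ i, M.V i) where
  carrier := {x | (∀ i, a ≤ toE i → x (i + 1) = M.φ i (x i)) ∧ ∀ i, b < toE i → x i = 0}
  add_mem' {x y} hx hy :=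
    ⟨fun i h => by simp [hx.1 i h, hy.1 i h], fun i h => by simp [hx.2 i h, hy.2 i h]⟩
  zero_mem' := ⟨fun i _ => by simp, fun i _ => rfl⟩
  smul_mem' c x hx := ⟨fun i h => by simp [hx.1 i h], fun i h => by simp [hx.2 i h]⟩

/-- The strings in `M.strings a b` generated by those that are born earlier or die earlier. -/
def stringsLT (M : PersMod F) (a b : Zigzag.EInt) : Submodule F (∀ i, M.V i) :=
  (⨆ a' : Set.Iio a, M.strings a' b) ⊔ ⨆ b' : Set.Iio b, M.strings a b'

variable {M : PersMod F}

theorem strings_mono {a a' b b' : Zigzag.EInt} (ha : a ≤ a') (hb : b ≤ b') :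
    M.strings a b ≤ M.strings a' b' := fun _ hx =>
  ⟨fun i h => hx.1 i (ha.trans h), fun i h => hx.2 i (hb.trans_lt h)⟩

theorem stringsLT_le (a b : Zigzag.EInt) : M.stringsLT a b ≤ M.strings a b :=
  sup_le (iSup_le fun a' => strings_mono a'.2.le le_rfl)
    (iSup_le fun b' => strings_mono le_rfl b'.2.le)

theorem strings_eq_zero_of_le {a b : Zigzag.EInt} {x : ∀ i, M.V i} (hx : x ∈ M.strings a b) {i j : ℤ}
    (ha : a ≤ toE i) (hi : x i = 0) (hij : i ≤ j) : x j = 0 := by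
  induction j, hij using Int.leInduction with
  | base => exact hi
  | succ j hij ih => rw [hx.1 j (ha.trans (toE_le_toE.2 hij)), ih, map_zero]

/-- A vector can be propagated to the right by the structure maps and to the left by any given
family of maps. -/
theorem exists_extension (M : PersMod F) (lift : ∀ j, M.V (j + 1) → M.V j) (i : ℤ) (w : M.V i) :
    ∃ x : ∀ j, M.V j, x i = w ∧ (∀ j, i ≤ j → x (j + 1) = M.φ j (x j)) ∧
      ∀ j, j < i → x j = lift j (x (j + 1)) := by
  have hk (k : ℤ) : k = k - 1 + 1 := by omega
  let x : ∀ j, M.V j := fun j => Int.inductionOn' (motive := M.V) j i w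
    (fun k _ v => M.φ k v) (fun k _ v => lift (k - 1) (hk k ▸ v))
  have hcast {m n : ℤ} (h : m = n) : (h ▸ x m) = x n := by subst h; rfl
  refine ⟨x, Int.inductionOn'_self .., fun j hj => Int.inductionOn'_add_one hj, fun j hj => ?_⟩
  obtain ⟨k, rfl⟩ : ∃ k, j = k - 1 := ⟨j + 1, by omega⟩
  have h : x (k - 1) = lift (k - 1) (hk k ▸ x k) :=
    Int.inductionOn'_sub_one (by omega)
  rw [h, hcast]

theorem exists_strings_eq (i : ℤ) (w : M.V i) : ∃ x ∈ M.strings (toE i) ⊤, x i = w := by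
  obtain ⟨x, hx, hr, -⟩ := M.exists_extension (fun _ _ => 0) i w
  exact ⟨x, ⟨fun j hj => hr j (toE_le_toE.1 hj), fun j hj => absurd hj not_top_lt⟩, hx⟩

/-- The values at `i` of the strings in `M.strings a b`. -/
def stringValues (M : PersMod F) (i : ℤ) (a b : Zigzag.EInt) : Submodule F (M.V i) :=
  (M.strings a b).map (LinearMap.proj i)

theorem stringValues_mono {i : ℤ} {a a' b b' : Zigzag.EInt} (ha : a ≤ a') (hb : b ≤ b') :
    M.stringValues i a b ≤ M.stringValues i a' b' :=
  Submodule.map_mono (strings_mono ha hb)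

theorem exists_stringValues_stable (hfd : ∀ i, FiniteDimensional F (M.V i)) (j : ℤ) :
    ∃ N ≤ j, ∀ n, M.stringValues j (toE N) ⊤ ≤ M.stringValues j (toE n) ⊤ := by
  let f : ℕ →o (Submodule F (M.V j))ᵒᵈ :=
    ⟨fun n => OrderDual.toDual (M.stringValues j (toE (-n)) ⊤), fun m n h =>
      OrderDual.toDual_le_toDual.2 (stringValues_mono (toE_le_toE.2 (by omega)) le_rfl)⟩
  obtain ⟨K, hK⟩ := IsArtinian.monotone_stabilizes f
  have hK' (m : ℕ) (hm : K ≤ m) :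
      M.stringValues j (toE (-K)) ⊤ = M.stringValues j (toE (-m)) ⊤ := hK m hm
  refine ⟨min (-K) j, min_le_right _ _, fun n => ?_⟩
  refine (stringValues_mono (toE_le_toE.2 (min_le_left _ _)) le_rfl).trans ?_
  rw [hK' (max K n.natAbs) (le_max_left _ _)]
  exact stringValues_mono (toE_le_toE.2 (by omega)) le_rfl

/-- A vector that comes from arbitrarily far left is the value of a string that extends
indefinitely to the left. -/
theorem exists_strings_bot_eq (hfd : ∀ i, FiniteDimensional F (M.V i)) (i : ℤ) (w : M.V i)
    (hw : ∀ n, w ∈ M.stringValues i (toE n) ⊤) : ∃ x ∈ M.strings ⊥ ⊤, x i = w := by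
  have key (j : ℤ) (w : M.V (j + 1)) : ∃ u : M.V j,
      (∀ n, w ∈ M.stringValues (j + 1) (toE n) ⊤) →
        (∀ n, u ∈ M.stringValues j (toE n) ⊤) ∧ M.φ j u = w := by
    by_cases hw : ∀ n, w ∈ M.stringValues (j + 1) (toE n) ⊤
    · obtain ⟨N, hN, hst⟩ := exists_stringValues_stable hfd j
      obtain ⟨x, hx, rfl⟩ := hw N
      exact ⟨x j, fun _ => ⟨fun n => hst n ⟨x, hx, rfl⟩, (hx.1 j (toE_le_toE.2 hN)).symm⟩⟩
    · exact ⟨0, fun h => absurd h hw⟩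
  choose lift hlift using key
  obtain ⟨x, rfl, hr, hl⟩ := M.exists_extension lift i w
  have hmem (d : ℕ) : ∀ j, j = i - d → ∀ n, x j ∈ M.stringValues j (toE n) ⊤ := by
    induction d with
    | zero => rintro j hj; obtain rfl : j = i := by simpa using hj
              exact hw
    | succ d ih =>
      intro j hj
      rw [hl j (by omega)]
      exact (hlift j _ (ih (j + 1) (by omega))).1
  refine ⟨x, ⟨fun j _ => ?_, fun j hj => absurd hj not_top_lt⟩, rfl⟩
  rcases le_or_gt i j with h | h
  · exact hr j h
  · have := (hlift j _ (hmem (i - (j + 1)).toNat (j + 1) (by omega))).2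
    rwa [← hl j h, eq_comm] at this

/-- A string whose value at `i` agrees with that of strings born or dying earlier is generated
by such strings. -/
theorem mem_stringsLT {a b : Zigzag.EInt} {i : ℤ} (hi : memI a b i) {x q : ∀ i, M.V i}
    (hx : x ∈ M.strings a b)
    (hq : q ∈ (⨆ a' : Set.Iio a, M.strings a' ⊤) ⊔ ⨆ b' : Set.Iio b, M.strings a b')
    (hxq : (x + q) i = 0) : x ∈ M.stringsLT a b := by
  obtain ⟨y, hy, z, hz, rfl⟩ := Submodule.mem_sup.1 hq
  have hy' : y ∈ M.strings a ⊤ := iSup_le (fun a' => strings_mono a'.2.le le_rfl) hy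
  have hz' : z ∈ M.strings a b := iSup_le (fun b' => strings_mono le_rfl b'.2.le) hz
  have hr : x + (y + z) ∈ M.strings a ⊤ :=
    add_mem (strings_mono le_rfl le_top hx) (add_mem hy' (strings_mono le_rfl le_top hz'))
  have hr0 (j : ℤ) (hj : i ≤ j) : (x + (y + z)) j = 0 := strings_eq_zero_of_le hr hi.1 hxq hj
  have hr' : x + (y + z) ∈ M.strings a (toE (i - 1)) :=
    ⟨hr.1, fun j hj => hr0 j (by have := toE_lt_toE.1 hj; omega)⟩
  have hyb (j : ℤ) (hj : b < toE j) : y j = 0 := by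
    have h := hr0 j (toE_le_toE.1 (hi.2.trans hj.le))
    simpa [hx.2 j hj, hz'.2 j hj] using h
  have hylt : y ∈ ⨆ a' : Set.Iio a, M.strings a' b := by
    by_cases hne : Nonempty (Set.Iio a)
    · have hdir : Directed (· ≤ ·) fun a' : Set.Iio a => M.strings a' ⊤ :=
        Monotone.directed_le fun _ _ h => strings_mono h le_rfl
      obtain ⟨a', ha'⟩ := (Submodule.mem_iSup_of_directed _ hdir).1 hy
      exact Submodule.mem_iSup_of_mem a' ⟨ha'.1, hyb⟩
    · have := not_nonempty_iff.1 hne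
      rw [iSup_of_empty] at hy ⊢
      exact hy
  have hrlt : x + (y + z) ∈ ⨆ b' : Set.Iio b, M.strings a b' :=
    Submodule.mem_iSup_of_mem ⟨toE (i - 1), Zigzag.EInt.toE_pred_lt hi.2⟩ hr'
  have : x = -y + (x + (y + z) - z) := by abel
  rw [this]
  exact Submodule.add_mem_sup (neg_mem hylt) (sub_mem hrlt hz)

/-- If a submodule `T` of `M.V i` contains the values of all strings of type `[a, b]` whenever it
contains those of the strings that are born or die earlier, then `T` is everything. -/
theorem eq_top_of_stringsLT (hfd : ∀ i, FiniteDimensional F (M.V i)) {i : ℤ}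
    (T : Submodule F (M.V i))
    (hT : ∀ a b, memI a b i → (M.stringsLT a b).map (LinearMap.proj i) ≤ T →
      M.stringValues i a b ≤ T) : T = ⊤ := by
  suffices h : ∀ a b, a ≤ toE i → M.stringValues i a b ≤ T by
    refine eq_top_iff.2 fun w _ => ?_
    obtain ⟨x, hx, rfl⟩ := exists_strings_eq i w
    exact h _ _ le_rfl ⟨x, hx, rfl⟩
  by_contra! hne
  obtain ⟨a₀, b₀, ha₀, hab₀⟩ := hne
  obtain ⟨W, ⟨⟨a₁, b₁, ha₁, rfl⟩, hWT⟩, hmin⟩ := wellFounded_lt.has_min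
    {W : Submodule F (M.V i) | (∃ a b, a ≤ toE i ∧ M.stringValues i a b = W) ∧ ¬ W ≤ T}
    ⟨_, ⟨a₀, b₀, ha₀, rfl⟩, hab₀⟩
  set W := M.stringValues i a₁ b₁
  have hlt {a b : Zigzag.EInt} (ha : a ≤ toE i) (hle : M.stringValues i a b ≤ W)
      (hne : M.stringValues i a b ≠ W) : M.stringValues i a b ≤ T := by
    by_contra h
    exact hmin _ ⟨⟨a, b, ha, rfl⟩, h⟩ (lt_of_le_of_ne hle hne)
  have hib {a b : Zigzag.EInt} (h : M.stringValues i a b = W) : toE i ≤ b := by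
    by_contra! hb
    refine hWT (h ▸ ?_)
    rintro _ ⟨x, hx, rfl⟩
    simp [hx.2 i hb]
  obtain ⟨b, ⟨a₂, ha₂, hb⟩, hbmin⟩ : ∃ b ∈ {b | ∃ a ≤ toE i, M.stringValues i a b = W},
      ∀ b' ∈ {b | ∃ a ≤ toE i, M.stringValues i a b = W}, b ≤ b' := by
    refine (Zigzag.EInt.exists_least_or {b | ∃ a ≤ toE i, M.stringValues i a b = W}
      ⟨b₁, a₁, ha₁, rfl⟩).resolve_right fun h => ?_
    obtain ⟨m, hm, a, -, ham⟩ := h (i - 1)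
    have := toE_le_toE.1 (hib ham)
    omega
  obtain ⟨a, ⟨ha, hab⟩, hamin⟩ : ∃ a ∈ {a | a ≤ toE i ∧ M.stringValues i a b = W},
      ∀ a' ∈ {a | a ≤ toE i ∧ M.stringValues i a b = W}, a ≤ a' := by
    refine (Zigzag.EInt.exists_least_or {a | a ≤ toE i ∧ M.stringValues i a b = W}
      ⟨a₂, ha₂, hb⟩).elim id fun h => ?_
    refine ⟨⊥, ⟨bot_le, le_antisymm (hb ▸ stringValues_mono bot_le le_rfl) fun w hw => ?_⟩,
      fun _ _ => bot_le⟩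
    have hall (n : ℤ) : w ∈ M.stringValues i (toE n) ⊤ := by
      obtain ⟨m, hm, -, hmW⟩ := h n
      exact stringValues_mono (toE_le_toE.2 hm) le_top (hmW ▸ hw)
    obtain ⟨x, hx, hxw⟩ := exists_strings_bot_eq hfd i w hall
    rw [← hb] at hw
    obtain ⟨y, hy, hyw⟩ := hw
    have hxy : x - y ∈ M.strings a₂ ⊤ :=
      sub_mem (strings_mono bot_le le_rfl hx) (strings_mono le_rfl le_top hy)
    refine ⟨x, ⟨hx.1, fun j hj => ?_⟩, hxw⟩
    have hyw' : y i = w := hyw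
    have h0 := strings_eq_zero_of_le hxy ha₂ (by simp [hxw, hyw'])
      (toE_le_toE.1 ((hib hb).trans hj.le))
    simpa [hy.2 j hj] using h0
  refine hWT (hab ▸ hT a b ⟨ha, hib hab⟩ ?_)
  rw [stringsLT, Submodule.map_sup, Submodule.map_iSup, Submodule.map_iSup]
  refine sup_le (iSup_le fun a' => ?_) (iSup_le fun b' => ?_)
  · exact hlt (a'.2.le.trans ha) (hab ▸ stringValues_mono a'.2.le le_rfl)
      fun h => (hamin _ ⟨a'.2.le.trans ha, h⟩).not_gt a'.2
  · exact hlt ha (hab ▸ stringValues_mono le_rfl b'.2.le)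
      fun h => (hbmin _ ⟨a, ha, h⟩).not_gt b'.2

/-- Strings that are independent modulo earlier ones in each type have independent values. -/
theorem linearIndependent_strings {ι : Zigzag.EInt → Zigzag.EInt → Type}
    {s : ∀ a b, ι a b → ∀ i, M.V i} (hs : ∀ a b k, s a b k ∈ M.strings a b)
    (hind : ∀ a b (c : ι a b →₀ F),
      Finsupp.linearCombination F (s a b) c ∈ M.stringsLT a b → c = 0) (i : ℤ) :
    LinearIndependent F fun j : {j : Σ p : {p : Zigzag.EInt × Zigzag.EInt // p.1 ≤ p.2}, ι p.1.1 p.1.2 //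
      memI j.1.1.1 j.1.1.2 i} => s _ _ j.1.2 i := by
  classical
  rw [linearIndependent_iff]
  intro l hl
  by_contra hl0
  obtain ⟨j₀, hj₀, hmax⟩ := l.support.exists_max_image
    (fun j => toLex (j.1.1.1.1, j.1.1.1.2)) (Finsupp.support_nonempty_iff.2 hl0)
  obtain ⟨⟨⟨⟨a, b⟩, hab⟩, t₀⟩, hi⟩ := j₀
  let f : ι a b → {j : Σ p : {p : Zigzag.EInt × Zigzag.EInt // p.1 ≤ p.2}, ι p.1.1 p.1.2 //
      memI j.1.1.1 j.1.1.2 i} := fun t => ⟨⟨⟨(a, b), hab⟩, t⟩, hi⟩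
  have hf : Function.Injective f := fun t t' h => by simpa [f] using h
  let c : ι a b →₀ F := l.comapDomain f hf.injOn
  suffices hc : Finsupp.linearCombination F (s a b) c ∈ M.stringsLT a b by
    have h := DFunLike.congr_fun (hind a b c hc) t₀
    exact Finsupp.mem_support_iff.1 hj₀ h
  have hsum : Finsupp.linearCombination F (s a b) c =
      ∑ j ∈ l.support with j ∈ Set.range f, l j • s _ _ j.1.2 := by
    rw [Finsupp.linearCombination_apply, Finsupp.sum, Finset.sum_filter,
      ← Finset.sum_preimage f l.support hf.injOn _ (fun j _ hj => if_neg hj)]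
    exact Finset.sum_congr rfl fun t _ => (if_pos ⟨t, rfl⟩).symm
  refine mem_stringsLT hi (q := ∑ j ∈ l.support with j ∉ Set.range f, l j • s _ _ j.1.2)
    ?_ ?_ ?_
  · rw [Finsupp.linearCombination_apply]
    exact sum_mem fun t _ => Submodule.smul_mem _ _ (hs a b t)
  · refine sum_mem fun j hj => Submodule.smul_mem _ _ ?_
    obtain ⟨hj, hjf⟩ := Finset.mem_filter.1 hj
    obtain ⟨⟨⟨⟨a', b'⟩, hab'⟩, t⟩, hi'⟩ := j
    rcases Prod.Lex.toLex_le_toLex.1 (hmax _ hj) with h | ⟨h, h'⟩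
    · exact Submodule.mem_sup_left (Submodule.mem_iSup_of_mem ⟨a', h⟩
        (strings_mono le_rfl le_top (hs a' b' t)))
    · obtain rfl : a' = a := h
      rcases lt_or_eq_of_le h' with h' | h'
      · exact Submodule.mem_sup_right (Submodule.mem_iSup_of_mem ⟨b', h'⟩ (hs a' b' t))
      · obtain rfl : b' = b := h'
        exact absurd ⟨t, rfl⟩ hjf
  · rw [hsum, Finset.sum_filter_add_sum_filter_not, Finset.sum_apply]
    simpa [Finsupp.linearCombination_apply, Finsupp.sum] using hl

/-- A family of strings whose values at each index form a basis yields an interval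
decomposition. -/
theorem nonempty_iso_dSum_interval {J : Type} (a b : J → Zigzag.EInt) (x : J → ∀ i, M.V i)
    (hx : ∀ j, x j ∈ M.strings (a j) (b j))
    (hli : ∀ i, LinearIndependent F fun j : {j // memI (a j) (b j) i} => x j i)
    (hsp : ∀ i, Submodule.span F
      (Set.range fun j : {j // memI (a j) (b j) i} => x j i) = ⊤) :
    Nonempty (Iso M (dSum fun j => interval F (a j) (b j))) := by
  classical
  let comp (i : ℤ) (j : J) : (PLift (memI (a j) (b j) i) → F) →ₗ[F] M.V i :=
    if h : memI (a j) (b j) i then (LinearMap.proj ⟨h⟩).smulRight (x j i) else 0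
  let Ψ (i : ℤ) : (⨁ j, (PLift (memI (a j) (b j) i) → F)) →ₗ[F] M.V i :=
    DirectSum.toModule F J _ (comp i)
  let Θ (i : ℤ) : ({j // memI (a j) (b j) i} →₀ F) →ₗ[F]
      ⨁ j, (PLift (memI (a j) (b j) i) → F) :=
    Finsupp.linearCombination F fun j =>
      DirectSum.lof F J (fun j => PLift (memI (a j) (b j) i) → F) j.1 fun _ => 1
  have hΨΘ (i : ℤ) (l) : Ψ i (Θ i l) =
      Finsupp.linearCombination F (fun j : {j // memI (a j) (b j) i} => x j i) l := by
    have : Ψ i ∘ₗ Θ i =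
        Finsupp.linearCombination F (fun j : {j // memI (a j) (b j) i} => x j i) := by
      ext j
      simp [Ψ, Θ, comp, j.2]
    exact LinearMap.congr_fun this l
  have hΘ (i : ℤ) : Function.Surjective (Θ i) := by
    rw [← LinearMap.range_eq_top, eq_top_iff]
    rintro u -
    induction u using DirectSum.induction_on with
    | zero => exact zero_mem _
    | add u v hu hv => exact add_mem hu hv
    | of j c =>
      by_cases h : memI (a j) (b j) i
      · refine ⟨Finsupp.single ⟨j, h⟩ (c ⟨h⟩), ?_⟩
        simp only [Θ, Finsupp.linearCombination_single, ← map_smul]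
        have hc : (c ⟨h⟩ • fun _ => 1) = c := funext fun p => by simp
        rw [hc]
        rfl
      · have : IsEmpty (PLift (memI (a j) (b j) i)) := ⟨fun p => h p.down⟩
        rw [Subsingleton.elim c 0, map_zero]
        exact zero_mem _
  have hΨ (i : ℤ) : Function.Bijective (Ψ i) := by
    constructor
    · rw [injective_iff_map_eq_zero]
      intro u hu
      obtain ⟨l, rfl⟩ := hΘ i u
      rw [hΨΘ] at hu
      rw [linearIndependent_iff.1 (hli i) l hu, map_zero]
    · intro w
      have hw : w ∈ Submodule.span F
          (Set.range fun j : {j // memI (a j) (b j) i} => x j i) := hsp i ▸ Submodule.mem_top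
      obtain ⟨l, hl⟩ := (Finsupp.mem_span_range_iff_exists_finsupp).1 hw
      exact ⟨Θ i l, by rw [hΨΘ, Finsupp.linearCombination_apply, hl]⟩
  let N := dSum fun j => interval F (a j) (b j)
  have hcomm (i : ℤ) (u : N.V i) : M.φ i (Ψ i u) = Ψ (i + 1) (N.φ i u) := by
    suffices h : M.φ i ∘ₗ Ψ i = Ψ (i + 1) ∘ₗ N.φ i from LinearMap.congr_fun h u
    refine DirectSum.linearMap_ext F fun j => LinearMap.ext fun c => ?_
    have hN : N.φ i (DirectSum.lof F J (fun j => PLift (memI (a j) (b j) i) → F) j c) =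
        DirectSum.lof F J (fun j => PLift (memI (a j) (b j) (i + 1)) → F) j
          (transferMap F LinearMap.id c) := by
      simp only [N, dSum]
      exact DirectSum.toModule_lof (M := fun j => PLift (memI (a j) (b j) i) → F) F j c
    have hΨlof (i : ℤ) (c) : Ψ i (DirectSum.lof F J
        (fun j => PLift (memI (a j) (b j) i) → F) j c) = comp i j c :=
      DirectSum.toModule_lof (M := fun j => PLift (memI (a j) (b j) i) → F) F j c
    change M.φ i (Ψ i (DirectSum.lof F J (fun j => PLift (memI (a j) (b j) i) → F) j c)) =
      Ψ (i + 1) (N.φ i (DirectSum.lof F J (fun j => PLift (memI (a j) (b j) i) → F) j c))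
    rw [hN, hΨlof, hΨlof]
    by_cases h : memI (a j) (b j) i
    · by_cases h' : memI (a j) (b j) (i + 1)
      · simp [comp, h, h', transferMap, (hx j).1 i h.1]
      · have h0 : x j (i + 1) = 0 := (hx j).2 _ <| by
          by_contra hb
          exact h' ⟨h.1.trans (toE_le_toE.2 (by omega)), not_lt.1 hb⟩
        simp [comp, h, h', ← (hx j).1 i h.1, h0]
    · by_cases h' : memI (a j) (b j) (i + 1) <;> simp [comp, h, h', transferMap]
  let E (i : ℤ) : N.V i ≃ₗ[F] M.V i := LinearEquiv.ofBijective (Ψ i) (hΨ i)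
  refine ⟨⟨fun i => (E i).symm, fun i w => ?_⟩⟩
  rw [LinearEquiv.symm_apply_eq]
  have := hcomm i ((E i).symm w)
  rwa [show Ψ i ((E i).symm w) = w from (E i).apply_symm_apply w] at this

end PersMod

/-- every discrete persistence module with finite-dimensional components
decomposes into a direct sum of interval persistence modules. -/
theorem stmt8 (F : Type) [Field F] (M : PersMod F)
    (hfd : ∀ i, FiniteDimensional F (M.V i)) :
    ∃ (J : Type) (a b : J → Zigzag.EInt), (∀ j, a j ≤ b j) ∧
      Nonempty (PersMod.Iso M (PersMod.dSum fun j => PersMod.interval F (a j) (b j))) := by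
  choose ι s hs hind hspan using fun a b =>
    Submodule.exists_basis_compl (PersMod.stringsLT_le (M := M) a b)
  let J := Σ p : {p : Zigzag.EInt × Zigzag.EInt // p.1 ≤ p.2}, ι p.1.1 p.1.2
  refine ⟨J, fun j => j.1.1.1, fun j => j.1.1.2, fun j => j.1.2,
    PersMod.nonempty_iso_dSum_interval _ _ (fun j => s _ _ j.2) (fun j => hs _ _ j.2)
      (PersMod.linearIndependent_strings hs hind) fun i =>
        PersMod.eq_top_of_stringsLT hfd _ fun a b hi hlt => ?_⟩
  refine (Submodule.map_mono (hspan a b)).trans ?_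
  rw [Submodule.map_sup, Submodule.map_span]
  refine sup_le (Submodule.span_mono ?_) hlt
  rintro _ ⟨_, ⟨t, rfl⟩, rfl⟩
  exact ⟨⟨⟨⟨(a, b), hi.1.trans hi.2⟩, t⟩, hi⟩, rfl⟩
end

section
/- For any zigzag persistence module V with finite-dimensional components and any integers s ≤ t, the restriction V|_[s,t] decomposes as a finite direct sum of interval modules I^[a_1,b_1] ⊕ ... ⊕ I^[a_n,b_n] with s ≤ a_i ≤ b_i ≤ t, and this decomposition is unique up to permutation of the summands. -/
open scoped DirectSum

namespace Zigzag

variable {F : Type} [Field F]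

/-- The structure maps of `M`, as a single relation covering both directions. -/
inductive Arrow (M : Zigzag F) : ∀ i j : ℤ, (M.V i →ₗ[F] M.V j) → Prop
  | f (i : ℤ) (h : Even i) : Arrow M i (i + 1) (M.f i h)
  | g (i : ℤ) (h : Even i) : Arrow M i (i - 1) (M.g i h)

namespace Arrow

variable {M : Zigzag F} {i j : ℤ} {u : M.V i →ₗ[F] M.V j}

lemma even (h : Arrow M i j u) : Even i := by
  cases h <;> assumption

lemma eq_or (h : Arrow M i j u) : j = i + 1 ∨ j = i - 1 := by
  cases h <;> simp

end Arrow

lemma exists_arrow (M : Zigzag F) {i j : ℤ} (hi : Even i) (hj : j = i + 1 ∨ j = i - 1) :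
    ∃ u, Arrow M i j u := by
  rcases hj with rfl | rfl
  exacts [⟨_, .f i hi⟩, ⟨_, .g i hi⟩]

/-- `x` is the family of images of `1` under a morphism from the interval module on `[a,b]`
to `M`. -/
structure IsVec (M : Zigzag F) (a b : ℤ) (x : ∀ i, M.V i) : Prop where
  off : ∀ i, ¬ (a ≤ i ∧ i ≤ b) → x i = 0
  map : ∀ i j u, Arrow M i j u → a ≤ i → i ≤ b → u (x i) = x j

/-- `φ` is a morphism from `M` to the interval module on `[a,b]`. -/
structure IsCov (M : Zigzag F) (a b : ℤ) (φ : ∀ i, M.V i →ₗ[F] F) : Prop where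
  off : ∀ i, ¬ (a ≤ i ∧ i ≤ b) → φ i = 0
  map : ∀ i j u, Arrow M i j u → a ≤ j → j ≤ b → ∀ v, φ j (u v) = φ i v

lemma IsVec.pairing_eq {M : Zigzag F} {a b a' b' i j : ℤ} {x : ∀ i, M.V i}
    {φ : ∀ i, M.V i →ₗ[F] F} {u : M.V i →ₗ[F] M.V j} (hx : IsVec M a b x) (hφ : IsCov M a' b' φ)
    (hu : Arrow M i j u) (hi : a ≤ i ∧ i ≤ b) (hj : a' ≤ j ∧ j ≤ b') :
    φ j (x j) = φ i (x i) := by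
  rw [← hx.map i j u hu hi.1 hi.2, hφ.map i j u hu hj.1 hj.2]

lemma IsVec.of_pairing_ne_zero {M : Zigzag F} {a b a' b' i : ℤ} {x : ∀ i, M.V i}
    {φ : ∀ i, M.V i →ₗ[F] F} (hx : IsVec M a b x) (hφ : IsCov M a' b' φ) (h : φ i (x i) ≠ 0) :
    (a ≤ i ∧ i ≤ b) ∧ (a' ≤ i ∧ i ≤ b') := by
  constructor <;> by_contra hc
  · exact h (by rw [hx.off i hc, map_zero])
  · exact h (by rw [hφ.off i hc, LinearMap.zero_apply])

lemma pairing_const {M : Zigzag F} {a b : ℤ} {x : ∀ i, M.V i} {φ : ∀ i, M.V i →ₗ[F] F}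
    (hx : IsVec M a b x) (hφ : IsCov M a b φ) {i : ℤ} (hi : a ≤ i) (hib : i ≤ b) :
    φ i (x i) = φ a (x a) := by
  induction i, hi using Int.leInduction with
  | base => rfl
  | succ i hi ih =>
    rw [← ih (by omega)]
    rcases Int.even_or_odd i with he | ho
    · obtain ⟨u, hu⟩ := M.exists_arrow (i := i) (j := i + 1) he (.inl rfl)
      exact hx.pairing_eq hφ hu ⟨hi, by omega⟩ ⟨by omega, hib⟩
    · obtain ⟨u, hu⟩ := M.exists_arrow (i := i + 1) (j := i) ho.add_one (.inr (by omega))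
      exact (hx.pairing_eq hφ hu ⟨by omega, hib⟩ ⟨hi, by omega⟩).symm

/-- A composite `I^[a,b] → I^[a',b'] → I^[a,b]` that factors through the scalars
`ψ i (x i)` and `φ i (y i)` is zero unless the intervals agree. -/
lemma interval_eq_of_pairing_ne_zero {M N : Zigzag F} {a b a' b' : ℤ}
    {x : ∀ i, M.V i} {φ : ∀ i, N.V i →ₗ[F] F} {y : ∀ i, N.V i} {ψ : ∀ i, M.V i →ₗ[F] F}
    (hx : IsVec M a b x) (hφ : IsCov N a b φ) (hy : IsVec N a' b' y) (hψ : IsCov M a' b' ψ)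
    (h : φ a (y a) * ψ a (x a) ≠ 0) : a' = a ∧ b' = b := by
  have mem : ∀ i, φ i (y i) * ψ i (x i) ≠ 0 → (a ≤ i ∧ i ≤ b) ∧ (a' ≤ i ∧ i ≤ b') :=
    fun i hi => hx.of_pairing_ne_zero hψ (right_ne_zero_of_mul hi)
  have step : ∀ i j, (j = i + 1 ∨ j = i - 1) → φ i (y i) * ψ i (x i) ≠ 0 →
      ((a ≤ j ∧ j ≤ b) ∨ (a' ≤ j ∧ j ≤ b')) → φ j (y j) * ψ j (x j) ≠ 0 := by
    intro i j hij hi hj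
    obtain ⟨hm, hm'⟩ := mem i hi
    have h1 := left_ne_zero_of_mul hi
    have h2 := right_ne_zero_of_mul hi
    rcases Int.even_or_odd i with he | ho
    · obtain ⟨u, hu⟩ := M.exists_arrow he hij
      obtain ⟨w, hw⟩ := N.exists_arrow he hij
      rcases hj with hj | hj
      · have e := hy.pairing_eq hφ hw hm' hj
        have hj' := (hy.of_pairing_ne_zero hφ (e ▸ h1)).1
        rw [e, hx.pairing_eq hψ hu hm hj']
        exact hi
      · have e := hx.pairing_eq hψ hu hm hj
        have hj' := (hx.of_pairing_ne_zero hψ (e ▸ h2)).1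
        rw [e, hy.pairing_eq hφ hw hm' hj']
        exact hi
    · have hje : Even j := by
        rcases hij with rfl | rfl
        exacts [ho.add_one, ho.sub_odd odd_one]
      obtain ⟨u, hu⟩ := M.exists_arrow (i := j) (j := i) hje (by omega)
      obtain ⟨w, hw⟩ := N.exists_arrow (i := j) (j := i) hje (by omega)
      rcases hj with hj | hj
      · have e := hx.pairing_eq hψ hu hj hm'
        have hj' := (hx.of_pairing_ne_zero hψ (e ▸ h2)).2
        rw [← e, ← hy.pairing_eq hφ hw hj' hm]
        exact hi
      · have e := hy.pairing_eq hφ hw hj hm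
        have hj' := (hy.of_pairing_ne_zero hφ (e ▸ h1)).2
        rw [← e, ← hx.pairing_eq hψ hu hj' hm']
        exact hi
  obtain ⟨ha, ha'⟩ := mem a h
  have hup : ∀ i, a ≤ i → (i ≤ b ∨ i ≤ b') → φ i (y i) * ψ i (x i) ≠ 0 := by
    intro i hi
    induction i, hi using Int.leInduction with
    | base => exact fun _ => h
    | succ i hi ih =>
      intro hb
      exact step i (i + 1) (.inl rfl) (ih (by omega)) (by omega)
  have h1 := mem b (hup b ha.2 (.inl le_rfl))
  have h2 := mem b' (hup b' ha'.2 (.inr le_rfl))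
  refine ⟨?_, by omega⟩
  by_contra hne
  have h3 := mem (a - 1) (step a (a - 1) (.inr rfl) h (by omega))
  omega

/-- Families of vectors and covectors exhibiting `M` as a direct sum of interval modules. -/
structure IsSplitting (M : Zigzag F) {n : ℕ} (a b : Fin n → ℤ) (x : Fin n → ∀ i, M.V i)
    (φ : Fin n → ∀ i, M.V i →ₗ[F] F) : Prop where
  vec : ∀ j, IsVec M (a j) (b j) (x j)
  cov : ∀ j, IsCov M (a j) (b j) (φ j)
  pairing : ∀ j k i, a j ≤ i → i ≤ b j → φ j i (x k i) = if j = k then 1 else 0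
  sum : ∀ i v, ∑ j, φ j i v • x j i = v

namespace IsSplitting

variable {M N : Zigzag F} {n n' : ℕ} {a b : Fin n → ℤ} {a' b' : Fin n' → ℤ}
  {x : Fin n → ∀ i, M.V i} {φ : Fin n → ∀ i, M.V i →ₗ[F] F}

lemma sum_pairing_smul (h : IsSplitting M a b x φ) {y : Fin n → ∀ i, N.V i}
    {ψ : Fin n → ∀ i, N.V i →ₗ[F] F} (h' : IsSplitting N a b y ψ) (i : ℤ) (v : M.V i) :
    ∑ j, ψ j i (∑ k, φ k i v • y k i) • x j i = v := by
  conv_rhs => rw [← h.sum i v]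
  refine Finset.sum_congr rfl fun j _ => ?_
  by_cases hj : a j ≤ i ∧ i ≤ b j
  · simp [map_sum, h'.pairing j _ i hj.1 hj.2]
  · simp [(h.vec j).off i hj]

lemma map_sum_smul (h : IsSplitting M a b x φ) {y : Fin n → ∀ i, N.V i}
    {ψ : Fin n → ∀ i, N.V i →ₗ[F] F} (h' : IsSplitting N a b y ψ) {i j : ℤ}
    {u : M.V i →ₗ[F] M.V j} {w : N.V i →ₗ[F] N.V j} (hu : Arrow M i j u) (hw : Arrow N i j w)
    (v : M.V i) : ∑ k, φ k j (u v) • y k j = w (∑ k, φ k i v • y k i) := by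
  rw [map_sum]
  refine Finset.sum_congr rfl fun k _ => ?_
  rw [map_smul]
  by_cases hi : a k ≤ i ∧ i ≤ b k
  · rw [(h'.vec k).map i j w hw hi.1 hi.2]
    by_cases hj : a k ≤ j ∧ j ≤ b k
    · rw [(h.cov k).map i j u hu hj.1 hj.2]
    · rw [(h'.vec k).off j hj, smul_zero, smul_zero]
  · by_cases hj : a k ≤ j ∧ j ≤ b k
    · rw [(h.cov k).map i j u hu hj.1 hj.2, (h.cov k).off i hi]
      simp
    · rw [(h.cov k).off i hi, (h.cov k).off j hj]
      simp

/-- Two zigzag modules that split into the same intervals are isomorphic. -/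
noncomputable def iso (h : IsSplitting M a b x φ) {y : Fin n → ∀ i, N.V i}
    {ψ : Fin n → ∀ i, N.V i →ₗ[F] F} (h' : IsSplitting N a b y ψ) : Iso M N where
  e i := LinearEquiv.ofLinearMap
    (∑ k, (φ k i).smulRight (y k i)) (∑ k, (ψ k i).smulRight (x k i))
    (LinearMap.ext fun v => by
      simpa [LinearMap.sum_apply] using h'.sum_pairing_smul h i v)
    (LinearMap.ext fun v => by
      simpa [LinearMap.sum_apply] using h.sum_pairing_smul h' i v)
  comm_f i hi v := by
    simpa [LinearMap.sum_apply] using h.map_sum_smul h' (.f i hi) (.f i hi) v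
  comm_g i hi v := by
    simpa [LinearMap.sum_apply] using h.map_sum_smul h' (.g i hi) (.g i hi) v

lemma of_iso {y : Fin n → ∀ i, N.V i} {ψ : Fin n → ∀ i, N.V i →ₗ[F] F}
    (h : IsSplitting N a b y ψ) (e : Iso M N) :
    IsSplitting M a b (fun j i => (e.e i).symm (y j i))
      (fun j i => (ψ j i).comp (e.e i).toLinearMap) where
  vec k :=
    { off := fun i hi => by simp [(h.vec k).off i hi]
      map := by
        intro i j u hu h1 h2
        cases hu with
        | f hi =>
          rw [LinearEquiv.eq_symm_apply, e.comm_f, LinearEquiv.apply_symm_apply,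
            (h.vec k).map _ _ _ (.f i hi) h1 h2]
        | g hi =>
          rw [LinearEquiv.eq_symm_apply, e.comm_g, LinearEquiv.apply_symm_apply,
            (h.vec k).map _ _ _ (.g i hi) h1 h2] }
  cov k :=
    { off := fun i hi => by simp [(h.cov k).off i hi]
      map := by
        intro i j u hu h1 h2 v
        cases hu with
        | f hi => simp [e.comm_f, (h.cov k).map _ _ _ (.f i hi) h1 h2]
        | g hi => simp [e.comm_g, (h.cov k).map _ _ _ (.g i hi) h1 h2] }
  pairing j k i h1 h2 := by simpa using h.pairing j k i h1 h2
  sum i v := by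
    apply (e.e i).injective
    simpa [map_sum] using h.sum i (e.e i v)

lemma card_le (h : IsSplitting M a b x φ) {y : Fin n' → ∀ i, M.V i}
    {ψ : Fin n' → ∀ i, M.V i →ₗ[F] F} (h' : IsSplitting M a' b' y ψ) (p : ℤ × ℤ)
    (hp : p.1 ≤ p.2) :
    Fintype.card {j // (a j, b j) = p} ≤ Fintype.card {k // (a' k, b' k) = p} := by
  obtain ⟨c, d⟩ := p
  let Q : Matrix {j // (a j, b j) = (c, d)} {k // (a' k, b' k) = (c, d)} F :=
    fun j k => φ j.1 c (y k.1 c)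
  let P : Matrix {k // (a' k, b' k) = (c, d)} {j // (a j, b j) = (c, d)} F :=
    fun k j => ψ k.1 c (x j.1 c)
  have hQP : Q * P = 1 := by
    ext ⟨j, hj⟩ ⟨l, hl⟩
    have hj' := hj
    have hl' := hl
    simp only [Prod.mk.injEq] at hj' hl'
    obtain ⟨hj1, hj2⟩ := hj'
    obtain ⟨hl1, hl2⟩ := hl'
    have key : ∑ k, φ j c (y k c) * ψ k c (x l c) = if j = l then 1 else 0 := by
      rw [← h.pairing j l c hj1.le (hj2 ▸ hp)]
      conv_rhs => rw [← h'.sum c (x l c)]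
      simp [map_sum, mul_comm]
    rw [Matrix.one_apply, Matrix.mul_apply]
    simp only [Subtype.mk.injEq]
    rw [← key]
    have hz : ∀ k, φ j c (y k c) * ψ k c (x l c) ≠ 0 → (a' k, b' k) = (c, d) := by
      intro k hk
      have hx := h.vec l
      have hφ := h.cov j
      rw [hl1, hl2] at hx
      rw [hj1, hj2] at hφ
      have := interval_eq_of_pairing_ne_zero hx hφ (h'.vec k) (h'.cov k) hk
      rw [this.1, this.2]
    rw [← Finset.sum_filter_of_ne (fun k _ => hz k)]
    exact (Finset.sum_subtype (p := fun k => (a' k, b' k) = (c, d))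
      (f := fun k => φ j c (y k c) * ψ k c (x l c)) _
      (fun k => by rw [Finset.mem_filter_univ])).symm
  calc Fintype.card {j // (a j, b j) = (c, d)} = (Q * P).rank := by rw [hQP, Matrix.rank_one]
    _ ≤ Q.rank := Matrix.rank_mul_le_left Q P
    _ ≤ _ := Matrix.rank_le_card_width Q

/-- Two splittings of the same module agree up to permutation. -/
lemma exists_equiv (h : IsSplitting M a b x φ) {y : Fin n' → ∀ i, M.V i}
    {ψ : Fin n' → ∀ i, M.V i →ₗ[F] F} (h' : IsSplitting M a' b' y ψ)
    (hab : ∀ j, a j ≤ b j) (hab' : ∀ j, a' j ≤ b' j) :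
    ∃ σ : Fin n ≃ Fin n', ∀ j, a j = a' (σ j) ∧ b j = b' (σ j) := by
  have hcard : ∀ p : ℤ × ℤ, Nonempty ({j // (a j, b j) = p} ≃ {k // (a' k, b' k) = p}) := by
    intro p
    by_cases hp : p.1 ≤ p.2
    · exact Fintype.card_eq.1 (le_antisymm (h.card_le h' p hp) (h'.card_le h p hp))
    · have : IsEmpty {j // (a j, b j) = p} := ⟨fun j => hp (j.2 ▸ hab j.1)⟩
      have : IsEmpty {k // (a' k, b' k) = p} := ⟨fun j => hp (j.2 ▸ hab' j.1)⟩
      exact ⟨Equiv.equivOfIsEmpty _ _⟩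
  refine ⟨Equiv.ofFiberEquiv fun p => (hcard p).some, fun j => ?_⟩
  have := Equiv.ofFiberEquiv_map (fun p => (hcard p).some) j
  simp only [Prod.mk.injEq] at this
  exact ⟨this.1.symm, this.2.symm⟩

end IsSplitting

lemma memI_toE (a b i : ℤ) : memI (toE a) (toE b) i ↔ a ≤ i ∧ i ≤ b := by
  simp [memI, toE]

open Classical in
/-- The canonical morphism from an interval module to the scalars at index `i`. -/
noncomputable def intervalEval (F : Type) [Field F] (a b : EInt) (i : ℤ) :
    (interval F a b).V i →ₗ[F] F where
  toFun v := if h : memI a b i then v ⟨h⟩ else 0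
  map_add' v w := by
    split_ifs with h
    exacts [rfl, (add_zero 0).symm]
  map_smul' c v := by
    split_ifs with h
    exacts [rfl, (smul_zero c).symm]

lemma intervalEval_of_mem {a b : EInt} {i : ℤ} (h : memI a b i) (v : (interval F a b).V i) :
    intervalEval F a b i v = v ⟨h⟩ :=
  dif_pos h

lemma intervalEval_of_notMem {a b : EInt} {i : ℤ} (h : ¬ memI a b i) :
    intervalEval F a b i = 0 :=
  LinearMap.ext fun _ => dif_neg h

lemma Arrow.interval_apply {a b : EInt} {i j : ℤ}
    {u : (interval F a b).V i →ₗ[F] (interval F a b).V j} (hu : Arrow (interval F a b) i j u)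
    (hj : memI a b j) (v : (interval F a b).V i) : u v ⟨hj⟩ = intervalEval F a b i v := by
  cases hu <;> rfl

/-- The generator of an interval module at index `i`. -/
def intervalOne (F : Type) [Field F] (a b : EInt) (i : ℤ) : (interval F a b).V i := fun _ => 1

lemma intervalEval_one {a b : EInt} {i : ℤ} (h : memI a b i) :
    intervalEval F a b i (intervalOne F a b i) = 1 := by
  rw [intervalEval_of_mem h, intervalOne]

lemma intervalEval_smul_one {a b : EInt} {i : ℤ} (v : (interval F a b).V i) :
    intervalEval F a b i v • intervalOne F a b i = v := by
  funext ⟨h⟩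
  rw [intervalEval_of_mem h]
  exact mul_one _

lemma isVec_intervalOne (a b : ℤ) :
    IsVec (interval F (toE a) (toE b)) a b (intervalOne F (toE a) (toE b)) where
  off i hi := funext fun ⟨h⟩ => absurd ((memI_toE a b i).1 h) hi
  map i j u hu h1 h2 := by
    funext ⟨h⟩
    rw [hu.interval_apply h, intervalEval_one ((memI_toE a b i).2 ⟨h1, h2⟩)]
    rfl

lemma isCov_intervalEval (a b : ℤ) :
    IsCov (interval F (toE a) (toE b)) a b (intervalEval F (toE a) (toE b)) where
  off i hi := intervalEval_of_notMem fun h => hi ((memI_toE a b i).1 h)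
  map i j u hu h1 h2 v := by
    have hj := (memI_toE a b j).2 ⟨h1, h2⟩
    rw [intervalEval_of_mem hj, hu.interval_apply hj]

section dSum

variable {J : Type} (W : J → Zigzag F)

open Classical in
/-- The inclusion of a summand into a direct sum. -/
noncomputable def dSumIncl (k : J) (i : ℤ) : (W k).V i →ₗ[F] (dSum W).V i :=
  DirectSum.lof F J (fun l => (W l).V i) k

/-- The projection of a direct sum onto a summand. -/
noncomputable def dSumProj (k : J) (i : ℤ) : (dSum W).V i →ₗ[F] (W k).V i :=
  DirectSum.component F J (fun l => (W l).V i) k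

lemma dSumProj_incl_self (k : J) (i : ℤ) (v : (W k).V i) :
    dSumProj W k i (dSumIncl W k i v) = v := by
  classical
  exact DirectSum.component.lof_self F (M := fun l => (W l).V i) k v

lemma dSumProj_incl_of_ne {k l : J} (h : l ≠ k) (i : ℤ) (v : (W l).V i) :
    dSumProj W k i (dSumIncl W l i v) = 0 := by
  classical
  exact (DirectSum.component.of F (M := fun l => (W l).V i) k l v).trans (dif_neg h)

lemma sum_dSumIncl_proj [Fintype J] (i : ℤ) (v : (dSum W).V i) :
    ∑ k, dSumIncl W k i (dSumProj W k i v) = v := by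
  classical
  exact DirectSum.sum_univ_of (β := fun l => (W l).V i) v

variable {W}

lemma Arrow.exists_dSumIncl {i j : ℤ} {u : (dSum W).V i →ₗ[F] (dSum W).V j}
    (hu : Arrow (dSum W) i j u) (k : J) :
    ∃ w, Arrow (W k) i j w ∧ ∀ v, u (dSumIncl W k i v) = dSumIncl W k j (w v) := by
  classical
  cases hu with
  | f h => exact ⟨_, .f i h, fun v =>
      DirectSum.toModule_lof (M := fun l => (W l).V i)
        (N := DirectSum J fun l => (W l).V (i + 1)) F k v⟩
  | g h => exact ⟨_, .g i h, fun v =>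
      DirectSum.toModule_lof (M := fun l => (W l).V i)
        (N := DirectSum J fun l => (W l).V (i - 1)) F k v⟩

lemma Arrow.exists_dSumProj [Fintype J] {i j : ℤ} {u : (dSum W).V i →ₗ[F] (dSum W).V j}
    (hu : Arrow (dSum W) i j u) (k : J) :
    ∃ w, Arrow (W k) i j w ∧ ∀ v, dSumProj W k j (u v) = w (dSumProj W k i v) := by
  choose w hw hv using hu.exists_dSumIncl
  refine ⟨w k, hw k, fun v => ?_⟩
  conv_lhs => rw [← sum_dSumIncl_proj W i v]
  simp only [map_sum, hv]
  rw [Finset.sum_eq_single k (fun l _ hl => dSumProj_incl_of_ne W hl j _) (by simp),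
    dSumProj_incl_self]

end dSum

lemma isSplitting_dSum (F : Type) [Field F] {n : ℕ} (a b : Fin n → ℤ) :
    IsSplitting (dSum fun j => interval F (toE (a j)) (toE (b j))) a b
      (fun j i => dSumIncl (fun j => interval F (toE (a j)) (toE (b j))) j i
        (intervalOne F (toE (a j)) (toE (b j)) i))
      (fun j i => (intervalEval F (toE (a j)) (toE (b j)) i).comp
        (dSumProj (fun j => interval F (toE (a j)) (toE (b j))) j i)) where
  vec k :=
    { off := fun i hi => by rw [(isVec_intervalOne (a k) (b k)).off i hi, map_zero]
      map := by
        intro i j u hu h1 h2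
        obtain ⟨w, hw, e⟩ := hu.exists_dSumIncl k
        rw [e, (isVec_intervalOne (a k) (b k)).map i j w hw h1 h2] }
  cov k :=
    { off := fun i hi => by rw [(isCov_intervalEval (a k) (b k)).off i hi, LinearMap.zero_comp]
      map := by
        intro i j u hu h1 h2 v
        obtain ⟨w, hw, e⟩ := hu.exists_dSumProj k
        rw [LinearMap.comp_apply, e, (isCov_intervalEval (a k) (b k)).map i j w hw h1 h2,
          LinearMap.comp_apply] }
  pairing j k i h1 h2 := by
    rw [LinearMap.comp_apply]
    split_ifs with h
    · subst h
      rw [dSumProj_incl_self, intervalEval_one ((memI_toE _ _ i).2 ⟨h1, h2⟩)]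
    · rw [dSumProj_incl_of_ne _ (Ne.symm h), map_zero]
  sum i v := by
    conv_rhs => rw [← sum_dSumIncl_proj _ i v]
    refine Finset.sum_congr rfl fun k _ => ?_
    rw [← map_smul, LinearMap.comp_apply, intervalEval_smul_one]

/-- A functional that vanishes on the kernel of `p` factors through `p`. -/
lemma exists_dual_factor {A B : Type*} [AddCommGroup A] [Module F A] [AddCommGroup B]
    [Module F B] (p : A →ₗ[F] B) (θ : A →ₗ[F] F) (h : ∀ x, p x = 0 → θ x = 0) :
    ∃ ψ : B →ₗ[F] F, ∀ x, ψ (p x) = θ x := by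
  have hθ : θ ∈ (LinearMap.ker p).dualAnnihilator := by
    rw [Submodule.mem_dualAnnihilator]
    exact fun x hx => h x hx
  rw [← LinearMap.range_dualMap_eq_dualAnnihilator_ker] at hθ
  obtain ⟨ψ, hψ⟩ := hθ
  exact ⟨ψ, fun x => LinearMap.congr_fun hψ x⟩

/-- The families of vectors that are compatible with the structure maps inside `[a,b]`. -/
def paths (M : Zigzag F) (a b : ℤ) : Submodule F (∀ i, M.V i) where
  carrier := {x | ∀ i j u, Arrow M i j u → a ≤ i → i ≤ b → a ≤ j → j ≤ b → u (x i) = x j}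
  zero_mem' i j u hu h1 h2 h3 h4 := map_zero u
  add_mem' {x y} hx hy i j u hu h1 h2 h3 h4 := by
    simp [hx i j u hu h1 h2 h3 h4, hy i j u hu h1 h2 h3 h4]
  smul_mem' c x hx i j u hu h1 h2 h3 h4 := by
    simp [hx i j u hu h1 h2 h3 h4]

/-- The families of functionals that are compatible with the structure maps inside `[a,b]`. -/
def IsCopath (M : Zigzag F) (a b : ℤ) (Φ : ∀ i, M.V i →ₗ[F] F) : Prop :=
  ∀ i j u, Arrow M i j u → a ≤ i → i ≤ b → a ≤ j → j ≤ b → ∀ v, Φ j (u v) = Φ i v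

section Extend

variable {M : Zigzag F} {a b c : ℤ} {x : ∀ i, M.V i} {Φ : ∀ i, M.V i →ₗ[F] F}

lemma paths_self (x : ∀ i, M.V i) : x ∈ M.paths a a := by
  intro i j u hu h1 h2 h3 h4
  have := hu.eq_or
  omega

lemma paths_mono (hbc : b ≤ c) (hx : x ∈ M.paths a c) : x ∈ M.paths a b :=
  fun i j u hu h1 h2 h3 h4 => hx i j u hu h1 (h2.trans hbc) h3 (h4.trans hbc)

lemma update_f_mem_paths (hb : Even b) (hx : x ∈ M.paths a b) :
    Function.update x (b + 1) (M.f b hb (x b)) ∈ M.paths a (b + 1) := by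
  intro i j u hu h1 h2 h3 h4
  have hij := hu.eq_or
  have hi := hu.even
  have hib : i ≠ b + 1 := by rintro rfl; exact Int.not_even_iff_odd.2 hb.add_one hi
  rw [Function.update_of_ne hib]
  by_cases hj : j = b + 1
  · obtain rfl : i = b := by omega
    cases hu with
    | f h => rw [Function.update_self]
    | g h => omega
  · rw [Function.update_of_ne hj]
    exact hx i j u hu h1 (by omega) h3 (by omega)

lemma update_mem_paths (hc : Even c) (hx : x ∈ M.paths a (c - 1)) {w : M.V c}
    (hw : M.g c hc w = x (c - 1)) : Function.update x c w ∈ M.paths a c := by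
  intro i j u hu h1 h2 h3 h4
  have hij := hu.eq_or
  have hi := hu.even
  by_cases hic : i = c
  · subst hic
    cases hu with
    | f h => omega
    | g h => rw [Function.update_self, Function.update_of_ne (by omega), hw]
  · have hjc : j ≠ c := by
      rintro rfl
      rcases hij with rfl | rfl
      · exact Int.not_even_iff_odd.2 hi.add_one hc
      · exact Int.not_even_iff_odd.2 (hi.sub_odd odd_one) hc
    rw [Function.update_of_ne hic, Function.update_of_ne hjc]
    exact hx i j u hu h1 (by omega) h3 (by omega)

lemma update_isCopath_of_even (hb : Even b) (hΦ : IsCopath M a b Φ) {ψ : M.V (b + 1) →ₗ[F] F}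
    (hψ : ψ.comp (M.f b hb) = Φ b) : IsCopath M a (b + 1) (Function.update Φ (b + 1) ψ) := by
  intro i j u hu h1 h2 h3 h4 v
  have hij := hu.eq_or
  have hi := hu.even
  have hib : i ≠ b + 1 := by rintro rfl; exact Int.not_even_iff_odd.2 hb.add_one hi
  rw [Function.update_of_ne hib]
  by_cases hj : j = b + 1
  · obtain rfl : i = b := by omega
    cases hu with
    | f h => rw [Function.update_self, ← hψ, LinearMap.comp_apply]
    | g h => omega
  · rw [Function.update_of_ne hj]
    exact hΦ i j u hu h1 (by omega) h3 (by omega) v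

lemma update_isCopath (hc : Even c) (hΦ : IsCopath M a (c - 1) Φ) {ψ : M.V c →ₗ[F] F}
    (hψ : (Φ (c - 1)).comp (M.g c hc) = ψ) : IsCopath M a c (Function.update Φ c ψ) := by
  intro i j u hu h1 h2 h3 h4 v
  have hij := hu.eq_or
  have hi := hu.even
  by_cases hic : i = c
  · subst hic
    cases hu with
    | f h => omega
    | g h => rw [Function.update_self, Function.update_of_ne (by omega), ← hψ,
        LinearMap.comp_apply]
  · have hjc : j ≠ c := by
      rintro rfl
      rcases hij with rfl | rfl
      · exact Int.not_even_iff_odd.2 hi.add_one hc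
      · exact Int.not_even_iff_odd.2 (hi.sub_odd odd_one) hc
    rw [Function.update_of_ne hic, Function.update_of_ne hjc]
    exact hΦ i j u hu h1 (by omega) h3 (by omega) v

/-- `φ` and `ψ` agree on all paths from `a` to `b`. -/
def Compat (M : Zigzag F) (a b : ℤ) (φ : M.V a →ₗ[F] F) (ψ : M.V b →ₗ[F] F) : Prop :=
  ∀ x ∈ M.paths a b, φ (x a) = ψ (x b)

variable {φ : M.V a →ₗ[F] F}

lemma Compat.of_even (hab : a ≤ b) (hb : Even b) {ψ : M.V (b + 1) →ₗ[F] F}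
    (h : Compat M a (b + 1) φ ψ) : Compat M a b φ (ψ.comp (M.f b hb)) := by
  intro x hx
  have := h _ (update_f_mem_paths hb hx)
  rwa [Function.update_self, Function.update_of_ne (by omega)] at this

lemma Compat.exists_of_even (hac : a ≤ c - 1) (hc : Even c) {ψ : M.V c →ₗ[F] F}
    (h : Compat M a c φ ψ) : ∃ ψ' : M.V (c - 1) →ₗ[F] F,
      ψ'.comp (M.g c hc) = ψ ∧ Compat M a (c - 1) φ ψ' := by
  let p : (M.paths a (c - 1)) × M.V c →ₗ[F] M.V (c - 1) :=
    ((LinearMap.proj (c - 1)).comp (M.paths a (c - 1)).subtype).coprod (M.g c hc)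
  let θ : (M.paths a (c - 1)) × M.V c →ₗ[F] F :=
    (φ.comp ((LinearMap.proj a).comp (M.paths a (c - 1)).subtype)).coprod ψ
  have hp : ∀ z, p z = z.1.1 (c - 1) + M.g c hc z.2 := fun z => rfl
  have hθ : ∀ z, θ z = φ (z.1.1 a) + ψ z.2 := fun z => rfl
  obtain ⟨ψ', h'⟩ := exists_dual_factor p θ (by
    intro z hz
    rw [hp] at hz
    have := h _ (update_mem_paths hc z.1.2 (w := -z.2)
      (by rw [map_neg]; exact (eq_neg_of_add_eq_zero_left hz).symm))
    rw [Function.update_self, Function.update_of_ne (by omega)] at this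
    rw [hθ, this, map_neg, neg_add_cancel])
  refine ⟨ψ', LinearMap.ext fun w => ?_, fun x hx => ?_⟩
  · simpa [hp, hθ] using h' (0, w)
  · simpa [hp, hθ] using (h' (⟨x, hx⟩, 0)).symm

/-- Compatible functionals at the two ends extend to a family of functionals. -/
lemma Compat.exists_isCopath (hab : a ≤ b) :
    ∀ {ψ : M.V b →ₗ[F] F}, Compat M a b φ ψ → ∃ Φ, IsCopath M a b Φ ∧ Φ a = φ ∧ Φ b = ψ := by
  induction b, hab using Int.leInduction with
  | base =>
    intro ψ h
    obtain rfl : φ = ψ := LinearMap.ext fun v => by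
      simpa using h (Function.update 0 a v) (paths_self _)
    refine ⟨Function.update 0 a φ, ?_, by simp, by simp⟩
    intro i j u hu h1 h2 h3 h4
    have := hu.eq_or
    omega
  | succ b hab ih =>
    rcases Int.even_or_odd b with hb | hb
    · intro ψ h
      obtain ⟨Φ, hΦ, h1, h2⟩ := ih (h.of_even hab hb)
      refine ⟨_, update_isCopath_of_even hb hΦ h2.symm, ?_, Function.update_self ..⟩
      rw [Function.update_of_ne (by omega), h1]
    · have hc := hb.add_one
      obtain ⟨c, rfl⟩ : ∃ c, b = c - 1 := ⟨b + 1, by omega⟩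
      rw [sub_add_cancel] at hc ⊢
      intro ψ h
      obtain ⟨ψ', h', hcompat⟩ := h.exists_of_even hab hc
      obtain ⟨Φ, hΦ, h1, h2⟩ := ih hcompat
      refine ⟨_, update_isCopath hc hΦ (h2 ▸ h'), ?_, Function.update_self ..⟩
      rw [Function.update_of_ne (by omega), h1]

/-- Extension by zero of a path to the right of `b` and to the left of `a`. -/
lemma exists_isVec (hx : x ∈ M.paths a b) (hab : a ≤ b) (hl : ∀ v : M.V (a - 1), v = 0)
    (hr : ∀ u, Arrow M b (b + 1) u → u (x b) = 0) : ∃ x', IsVec M a b x' ∧ x' a = x a := by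
  refine ⟨fun i => if a ≤ i ∧ i ≤ b then x i else 0, ⟨fun i hi => if_neg hi, ?_⟩,
    if_pos ⟨le_rfl, hab⟩⟩
  intro i j u hu h1 h2
  rw [if_pos ⟨h1, h2⟩]
  split_ifs with hj
  · exact hx i j u hu h1 h2 hj.1 hj.2
  · rcases hu.eq_or with rfl | rfl
    · obtain rfl : i = b := by omega
      exact hr u hu
    · obtain rfl : i = a := by omega
      exact hl _

/-- Extension by zero of a compatible family of functionals. -/
lemma exists_isCov (hΦ : IsCopath M a b Φ) (hab : a ≤ b) (hl : ∀ v : M.V (a - 1), v = 0)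
    (hr : ∀ i j u, Arrow M i j u → i = b + 1 → j = b → ∀ v, Φ j (u v) = 0) :
    ∃ Φ', IsCov M a b Φ' ∧ Φ' a = Φ a := by
  refine ⟨fun i => if a ≤ i ∧ i ≤ b then Φ i else 0, ⟨fun i hi => if_neg hi, ?_⟩,
    if_pos ⟨le_rfl, hab⟩⟩
  intro i j u hu h1 h2 v
  rw [if_pos ⟨h1, h2⟩]
  split_ifs with hi
  · exact hΦ i j u hu hi.1 hi.2 h1 h2 v
  · have hij := hu.eq_or
    by_cases hib : i = b + 1
    · exact hr i j u hu hib (by omega) v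
    · obtain rfl : j = a := by omega
      obtain rfl : i = j - 1 := by omega
      rw [hl v, map_zero, map_zero, map_zero]

/-- No vector at `a` dies on the way to `b`, and every vector at `a` extends to a path. -/
def Survives (M : Zigzag F) (a b : ℤ) : Prop :=
  (∀ x ∈ M.paths a b, x b = 0 → x a = 0) ∧ ∀ v : M.V a, ∃ x ∈ M.paths a b, x a = v

lemma survives_self (a : ℤ) : Survives M a a :=
  ⟨fun _ _ h => h, fun v => ⟨Function.update 0 a v, paths_self _, by simp⟩⟩

lemma Survives.exists_of_even (h : Survives M a b) (hab : a ≤ b) (hb : Even b)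
    (hl : ∀ v : M.V (a - 1), v = 0) (hn : ¬ Survives M a (b + 1)) :
    ∃ x φ, IsVec M a b x ∧ IsCov M a b φ ∧ φ a (x a) = 1 := by
  have hext : ∀ v : M.V a, ∃ x ∈ M.paths a (b + 1), x a = v := by
    intro v
    obtain ⟨x, hx, rfl⟩ := h.2 v
    exact ⟨_, update_f_mem_paths hb hx, Function.update_of_ne (by omega) ..⟩
  obtain ⟨x, hx, hxb, hxa⟩ : ∃ x ∈ M.paths a (b + 1), x (b + 1) = 0 ∧ x a ≠ 0 := by
    by_contra! hc
    exact hn ⟨hc, hext⟩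
  obtain ⟨φ, hφ⟩ := Module.Projective.exists_dual_ne_zero F hxa
  obtain ⟨ψ, hψ⟩ := exists_dual_factor ((LinearMap.proj b).comp (M.paths a b).subtype)
    (((φ (x a))⁻¹ • φ).comp ((LinearMap.proj a).comp (M.paths a b).subtype)) (by
      rintro ⟨y, hy⟩ hyb
      have : y a = 0 := h.1 y hy hyb
      simp [this])
  obtain ⟨Φ, hΦ, hΦa, -⟩ := Compat.exists_isCopath (M := M) (φ := (φ (x a))⁻¹ • φ) hab
    (ψ := ψ) fun y hy => (hψ ⟨y, hy⟩).symm
  obtain ⟨x', hx', hx'a⟩ := exists_isVec (paths_mono (by omega) hx) hab hl fun u hu => by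
    rw [hx b (b + 1) u hu hab (by omega) (by omega) le_rfl, hxb]
  obtain ⟨Φ', hΦ', hΦ'a⟩ := exists_isCov hΦ hab hl fun i j u hu hi hj =>
    absurd (hi ▸ hu.even) (Int.not_even_iff_odd.2 hb.add_one)
  refine ⟨x', Φ', hx', hΦ', ?_⟩
  rw [hx'a, hΦ'a, hΦa]
  simp [hφ]

lemma Survives.exists_of_odd (h : Survives M a (c - 1)) (hac : a ≤ c - 1) (hc : Even c)
    (hl : ∀ v : M.V (a - 1), v = 0) (hn : ¬ Survives M a c) :
    ∃ x φ, IsVec M a (c - 1) x ∧ IsCov M a (c - 1) φ ∧ φ a (x a) = 1 := by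
  have hdie : ∀ x ∈ M.paths a c, x c = 0 → x a = 0 := by
    intro x hx hxc
    refine h.1 x (paths_mono (by omega) hx) ?_
    rw [← hx c (c - 1) _ (.g c hc) (by omega) le_rfl hac (by omega), hxc, map_zero]
  obtain ⟨v, hv⟩ : ∃ v : M.V a, v ∉ (M.paths a c).map (LinearMap.proj a) := by
    by_contra! hcon
    exact hn ⟨hdie, fun v => hcon v⟩
  obtain ⟨φ, hφv, hφ⟩ := Submodule.exists_le_ker_of_notMem hv
  have hcompat : Compat M a c ((φ v)⁻¹ • φ) 0 := by
    intro y hy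
    have : φ (y a) = 0 := hφ ⟨y, hy, rfl⟩
    simp [this]
  obtain ⟨ψ, hψ, hψc⟩ := hcompat.exists_of_even hac hc
  obtain ⟨Φ, hΦ, hΦa, hΦc⟩ := hψc.exists_isCopath hac
  obtain ⟨x, hx, hxa⟩ := h.2 v
  obtain ⟨x', hx', hx'a⟩ := exists_isVec hx hac hl fun u hu =>
    absurd hu.even (Int.not_even_iff_odd.2 (hc.sub_odd odd_one))
  obtain ⟨Φ', hΦ', hΦ'a⟩ := exists_isCov hΦ hac hl (by
    intro i j u hu hi hj w
    obtain rfl : i = c := by omega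
    cases hu with
    | f _ => omega
    | g _ => rw [hΦc]; exact LinearMap.congr_fun hψ w)
  refine ⟨x', Φ', hx', hΦ', ?_⟩
  rw [hx'a, hΦ'a, hΦa, hxa]
  simp [hφv]

end Extend

/-- A nonzero module supported on `[s,t]` has an interval module as a retract. -/
lemma exists_retract (M : Zigzag F) {s t : ℤ} (hM : ∀ i, ¬ (s ≤ i ∧ i ≤ t) → ∀ v : M.V i, v = 0)
    (h0 : ¬ M.IsZero) : ∃ (a b : ℤ) (x : _) (φ : _), s ≤ a ∧ a ≤ b ∧ b ≤ t ∧
      IsVec M a b x ∧ IsCov M a b φ ∧ φ a (x a) = 1 := by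
  obtain ⟨a, ⟨v, hv⟩, hmin⟩ := Int.exists_least_of_bdd (P := fun i => ∃ v : M.V i, v ≠ 0)
    ⟨s, fun i ⟨v, hv⟩ => by by_contra hi; exact hv (hM i (by omega) v)⟩
    (by simpa [IsZero] using h0)
  have hl : ∀ w : M.V (a - 1), w = 0 := by
    intro w
    by_contra hw
    have := hmin _ ⟨w, hw⟩
    omega
  suffices ∃ b x φ, a ≤ b ∧ IsVec M a b x ∧ IsCov M a b φ ∧ φ a (x a) = 1 by
    obtain ⟨b, x, φ, hab, hx, hφ, h1⟩ := this
    have hb : φ b (x b) ≠ 0 := by rw [pairing_const hx hφ hab le_rfl, h1]; exact one_ne_zero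
    refine ⟨a, b, x, φ, ?_, hab, ?_, hx, hφ, h1⟩
    · by_contra hs
      exact hv (hM a (by omega) v)
    · by_contra ht
      exact hb (by rw [hM b (by omega) (x b), map_zero])
  by_contra! hno
  have hsurv : ∀ b, a ≤ b → Survives M a b := by
    intro b hab
    induction b, hab using Int.leInduction with
    | base => exact survives_self a
    | succ b hab ih =>
      by_contra hn
      rcases Int.even_or_odd b with hb | hb
      · obtain ⟨x, φ, hx, hφ, h1⟩ := ih.exists_of_even hab hb hl hn
        exact hno b x φ hab hx hφ h1
      · obtain ⟨c, rfl⟩ : ∃ c, b = c - 1 := ⟨b + 1, by omega⟩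
        have hc := hb.add_one
        rw [sub_add_cancel] at hc hn
        obtain ⟨x, φ, hx, hφ, h1⟩ := ih.exists_of_odd hab hc hl hn
        exact hno _ x φ hab hx hφ h1
  obtain ⟨h1, h2⟩ := hsurv (max a (t + 1)) (le_max_left _ _)
  obtain ⟨x, hx, rfl⟩ := h2 v
  exact hv (h1 x hx (hM _ (by omega) _))

section Kernel

variable {M : Zigzag F} {a b : ℤ} {x : ∀ i, M.V i} {φ : ∀ i, M.V i →ₗ[F] F}

lemma IsCov.map_ker (hφ : IsCov M a b φ) {i j : ℤ} {u : M.V i →ₗ[F] M.V j} (hu : Arrow M i j u)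
    (v : M.V i) (hv : v ∈ LinearMap.ker (φ i)) : u v ∈ LinearMap.ker (φ j) := by
  rw [LinearMap.mem_ker] at hv ⊢
  by_cases hj : a ≤ j ∧ j ≤ b
  · rw [hφ.map i j u hu hj.1 hj.2, hv]
  · rw [hφ.off j hj, LinearMap.zero_apply]

/-- The kernel of a morphism to an interval module. -/
def IsCov.kernel (hφ : IsCov M a b φ) : Zigzag F where
  V i := LinearMap.ker (φ i)
  acg i := inferInstance
  mod i := inferInstance
  f i hi := (M.f i hi).restrict (hφ.map_ker (.f i hi))
  g i hi := (M.g i hi).restrict (hφ.map_ker (.g i hi))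

/-- The inclusion of the kernel of a morphism to an interval module. -/
def IsCov.kernelIncl (hφ : IsCov M a b φ) (i : ℤ) : hφ.kernel.V i →ₗ[F] M.V i :=
  (LinearMap.ker (φ i)).subtype

lemma IsCov.kernelIncl_injective (hφ : IsCov M a b φ) (i : ℤ) :
    Function.Injective (hφ.kernelIncl i) :=
  Subtype.val_injective

lemma IsCov.apply_kernelIncl (hφ : IsCov M a b φ) (i : ℤ) (v : hφ.kernel.V i) :
    φ i (hφ.kernelIncl i v) = 0 :=
  v.2

lemma IsCov.exists_arrow_kernel (hφ : IsCov M a b φ) {i j : ℤ} {u : M.V i →ₗ[F] M.V j}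
    (hu : Arrow M i j u) : ∃ w, Arrow hφ.kernel i j w ∧
      ∀ v, hφ.kernelIncl j (w v) = u (hφ.kernelIncl i v) := by
  cases hu with
  | f h => exact ⟨_, .f i h, fun _ => rfl⟩
  | g h => exact ⟨_, .g i h, fun _ => rfl⟩

lemma retract_aux (hx : IsVec M a b x) (hφ : IsCov M a b φ) (h1 : φ a (x a) = 1) (i : ℤ)
    (v : M.V i) : φ i (v - φ i v • x i) = 0 := by
  by_cases hi : a ≤ i ∧ i ≤ b
  · rw [map_sub, map_smul, pairing_const hx hφ hi.1 hi.2, h1, smul_eq_mul, mul_one, sub_self]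
  · rw [hφ.off i hi, LinearMap.zero_apply]

/-- The projection onto the kernel of a retraction to an interval module. -/
def kernelProj (hx : IsVec M a b x) (hφ : IsCov M a b φ) (h1 : φ a (x a) = 1) (i : ℤ) :
    M.V i →ₗ[F] hφ.kernel.V i :=
  (LinearMap.id - (φ i).smulRight (x i)).codRestrict (LinearMap.ker (φ i))
    (retract_aux hx hφ h1 i)

variable (hx : IsVec M a b x) (hφ : IsCov M a b φ) (h1 : φ a (x a) = 1)

lemma kernelIncl_proj (i : ℤ) (v : M.V i) :
    hφ.kernelIncl i (kernelProj hx hφ h1 i v) = v - φ i v • x i :=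
  rfl

lemma kernelProj_incl (i : ℤ) (v : hφ.kernel.V i) :
    kernelProj hx hφ h1 i (hφ.kernelIncl i v) = v := by
  apply hφ.kernelIncl_injective i
  rw [kernelIncl_proj, hφ.apply_kernelIncl, zero_smul, sub_zero]

lemma kernelProj_self (i : ℤ) : kernelProj hx hφ h1 i (x i) = 0 := by
  apply hφ.kernelIncl_injective i
  rw [kernelIncl_proj, map_zero]
  by_cases hi : a ≤ i ∧ i ≤ b
  · rw [pairing_const hx hφ hi.1 hi.2, h1, one_smul, sub_self]
  · rw [hx.off i hi, smul_zero, sub_zero]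

lemma kernelProj_map {i j : ℤ} {u : M.V i →ₗ[F] M.V j} (hu : Arrow M i j u)
    {w : hφ.kernel.V i →ₗ[F] hφ.kernel.V j}
    (hw : ∀ v, hφ.kernelIncl j (w v) = u (hφ.kernelIncl i v)) (v : M.V i) :
    kernelProj hx hφ h1 j (u v) = w (kernelProj hx hφ h1 i v) := by
  apply hφ.kernelIncl_injective j
  rw [hw, kernelIncl_proj, kernelIncl_proj, map_sub, map_smul, sub_right_inj]
  by_cases hi : a ≤ i ∧ i ≤ b
  · rw [hx.map i j u hu hi.1 hi.2]
    by_cases hj : a ≤ j ∧ j ≤ b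
    · rw [hφ.map i j u hu hj.1 hj.2]
    · rw [hx.off j hj, smul_zero, smul_zero]
  · rw [hφ.off i hi, LinearMap.zero_apply, zero_smul]
    by_cases hj : a ≤ j ∧ j ≤ b
    · rw [hφ.map i j u hu hj.1 hj.2, hφ.off i hi, LinearMap.zero_apply, zero_smul]
    · rw [hx.off j hj, smul_zero]

/-- A splitting of the kernel of a retraction to an interval module extends to a splitting of
the whole module. -/
lemma IsSplitting.cons {n : ℕ} {a' b' : Fin n → ℤ} {y : Fin n → ∀ i, hφ.kernel.V i}
    {ψ : Fin n → ∀ i, hφ.kernel.V i →ₗ[F] F} (h : IsSplitting hφ.kernel a' b' y ψ) :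
    IsSplitting M (Matrix.vecCons a a') (Matrix.vecCons b b')
      (Matrix.vecCons x fun j i => hφ.kernelIncl i (y j i))
      (Matrix.vecCons φ fun j i => (ψ j i).comp (kernelProj hx hφ h1 i)) where
  vec := by
    refine Fin.cases hx fun k => ⟨fun i hi => ?_, fun i j u hu hi1 hi2 => ?_⟩
    · simp only [Matrix.cons_val_succ] at hi ⊢
      rw [(h.vec k).off i hi, map_zero]
    · simp only [Matrix.cons_val_succ] at hi1 hi2 ⊢
      obtain ⟨w, hw, e⟩ := hφ.exists_arrow_kernel hu
      rw [← e, (h.vec k).map i j w hw hi1 hi2]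
  cov := by
    refine Fin.cases hφ fun k => ⟨fun i hi => ?_, fun i j u hu hj1 hj2 v => ?_⟩
    · simp only [Matrix.cons_val_succ] at hi ⊢
      rw [(h.cov k).off i hi, LinearMap.zero_comp]
    · simp only [Matrix.cons_val_succ, LinearMap.comp_apply] at hj1 hj2 ⊢
      obtain ⟨w, hw, e⟩ := hφ.exists_arrow_kernel hu
      rw [kernelProj_map hx hφ h1 hu e, (h.cov k).map i j w hw hj1 hj2]
  pairing := by
    refine Fin.cases ?_ fun j => ?_ <;> refine Fin.cases ?_ fun k => ?_ <;> intro i hi1 hi2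
    · simp only [Matrix.cons_val_zero] at hi1 hi2 ⊢
      rw [pairing_const hx hφ hi1 hi2, h1, if_true]
    · simp only [Matrix.cons_val_zero, Matrix.cons_val_succ]
      rw [hφ.apply_kernelIncl, if_neg (Fin.succ_ne_zero k).symm]
    · simp only [Matrix.cons_val_zero, Matrix.cons_val_succ, LinearMap.comp_apply]
      rw [kernelProj_self, map_zero, if_neg (Fin.succ_ne_zero j)]
    · simp only [Matrix.cons_val_succ, LinearMap.comp_apply] at hi1 hi2 ⊢
      rw [kernelProj_incl, h.pairing j k i hi1 hi2]
      simp
  sum i v := by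
    rw [Fin.sum_univ_succ]
    simp only [Matrix.cons_val_zero, Matrix.cons_val_succ, LinearMap.comp_apply]
    simp only [← map_smul, ← map_sum]
    rw [h.sum, kernelIncl_proj, add_sub_cancel]

end Kernel

/-- Every finite-dimensional zigzag module with bounded support splits into intervals. -/
theorem exists_isSplitting (s t : ℤ) (M : Zigzag F) (hfd : ∀ i, FiniteDimensional F (M.V i))
    (hM : ∀ i, ¬ (s ≤ i ∧ i ≤ t) → ∀ v : M.V i, v = 0) :
    ∃ (n : ℕ) (a b : Fin n → ℤ) (x : _) (φ : _), (∀ j, s ≤ a j ∧ a j ≤ b j ∧ b j ≤ t) ∧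
      IsSplitting M a b x φ := by
  induction hN : ∑ i ∈ Finset.Icc s t, Module.finrank F (M.V i) using Nat.strong_induction_on
    generalizing M with
  | _ N ih =>
    by_cases h0 : M.IsZero
    · refine ⟨0, Fin.elim0, Fin.elim0, fun j => j.elim0, fun j => j.elim0, fun j => j.elim0,
        fun j => j.elim0, fun j => j.elim0, fun j => j.elim0, fun i v => ?_⟩
      rw [h0 i v, Finset.univ_eq_empty, Finset.sum_empty]
    · obtain ⟨a, b, x, φ, hsa, hab, hbt, hx, hφ, h1⟩ := M.exists_retract hM h0
      have hlt : ∑ i ∈ Finset.Icc s t, Module.finrank F (hφ.kernel.V i) < N := by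
        rw [← hN]
        refine Finset.sum_lt_sum
          (fun i _ => LinearMap.finrank_le_finrank_of_injective (hφ.kernelIncl_injective i))
          ⟨a, Finset.mem_Icc.2 ⟨hsa, hab.trans hbt⟩, ?_⟩
        refine lt_of_le_of_ne
          (LinearMap.finrank_le_finrank_of_injective (hφ.kernelIncl_injective a)) fun heq => ?_
        have : FiniteDimensional F (hφ.kernel.V a) :=
          Module.Finite.of_injective _ (hφ.kernelIncl_injective a)
        obtain ⟨w, hw⟩ := (LinearMap.injective_iff_surjective_of_finrank_eq_finrank heq).1
          (hφ.kernelIncl_injective a) (x a)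
        have := hφ.apply_kernelIncl a w
        rw [hw, h1] at this
        exact one_ne_zero this
      obtain ⟨n, a', b', y, ψ, hab', h⟩ := ih _ hlt hφ.kernel
        (fun i => Module.Finite.of_injective _ (hφ.kernelIncl_injective i))
        (fun i hi v => hφ.kernelIncl_injective i (by rw [hM i hi (hφ.kernelIncl i v), map_zero]))
        rfl
      exact ⟨n + 1, _, _, _, _, Fin.cases ⟨hsa, hab, hbt⟩ hab', h.cons hx hφ h1⟩

end Zigzag


open Zigzag in
/-- the restriction `V|_[s,t]` decomposes as a finite direct sum of interval
modules supported in `[s,t]`, uniquely up to permutation of the summands. -/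
theorem stmt12 (F : Type) [Field F] (V : Zigzag F)
    (hfd : ∀ i, FiniteDimensional F (V.V i)) (s t : ℤ) (hst : s ≤ t) :
    ∃ (n : ℕ) (a b : Fin n → ℤ), (∀ j, s ≤ a j ∧ a j ≤ b j ∧ b j ≤ t) ∧
      Nonempty (Iso (V.restrict s t)
        (dSum fun j => interval F (toE (a j)) (toE (b j)))) ∧
      ∀ (n' : ℕ) (a' b' : Fin n' → ℤ), (∀ j, s ≤ a' j ∧ a' j ≤ b' j ∧ b' j ≤ t) →
        Nonempty (Iso (V.restrict s t)
          (dSum fun j => interval F (toE (a' j)) (toE (b' j)))) →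
        ∃ σ : Fin n ≃ Fin n', ∀ j, a j = a' (σ j) ∧ b j = b' (σ j) := by
  have hM : ∀ i, ¬ (s ≤ i ∧ i ≤ t) → ∀ v : (V.restrict s t).V i, v = 0 :=
    fun i hi v => funext fun h => absurd h.down hi
  have hfd' : ∀ i, FiniteDimensional F ((V.restrict s t).V i) := fun i =>
    inferInstanceAs (FiniteDimensional F (PLift (s ≤ i ∧ i ≤ t) → V.V i))
  obtain ⟨n, a, b, x, φ, hab, h⟩ := exists_isSplitting s t (V.restrict s t) hfd' hM
  refine ⟨n, a, b, hab, ⟨h.iso (isSplitting_dSum F a b)⟩, fun n' a' b' hab' ⟨e⟩ => ?_⟩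
  exact h.exists_equiv ((isSplitting_dSum F a' b').of_iso e) (fun j => (hab j).2.1)
    fun j => (hab' j).2.1
end
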